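/- arXiv:2406.00469 — 5 statements merged into one kernel-verified Lean document; each statement's English description precedes it below -/
import Mathlib

section
/- Let X ∈ ℝ^{n×p} with XᵀX = I_p, let W ∈ ℝ^{n×n} be skew-symmetric, and define the Cayley curve Y(τ) = (I_n + (τ/2)W)⁻¹(I_n − (τ/2)W) X for τ ∈ ℝ. Then Y is differentiable in τ at every τ ∈ ℝ, with derivative Y′(τ) = −(I_n + (τ/2)W)⁻¹ W ((X + Y(τ))/2). -/
open Matrix

theorem cayley_det_ne {n : ℕ} (W : Matrix (Fin n) (Fin n) ℝ) (hW : Wᵀ = -W) (s : ℝ) :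
    ((1 : Matrix (Fin n) (Fin n) ℝ) + s • W).det ≠ 0 := by
  intro h
  obtain ⟨v, hv, h0⟩ := Matrix.exists_mulVec_eq_zero_iff.2 h
  apply hv
  have h1 : v ⬝ᵥ (W *ᵥ v) = 0 := by
    have h2 : v ⬝ᵥ (W *ᵥ v) = - (v ⬝ᵥ (W *ᵥ v)) := by
      conv_lhs => rw [Matrix.dotProduct_mulVec, ← Matrix.mulVec_transpose, hW,
        Matrix.neg_mulVec, neg_dotProduct, dotProduct_comm]
    linarith
  have h3 : v ⬝ᵥ (((1 : Matrix (Fin n) (Fin n) ℝ) + s • W) *ᵥ v) = 0 := by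
    rw [h0, dotProduct_zero]
  rw [Matrix.add_mulVec, Matrix.one_mulVec, Matrix.smul_mulVec, dotProduct_add,
    dotProduct_smul, h1, smul_zero, add_zero] at h3
  exact dotProduct_self_eq_zero.1 h3

/-- The Cayley curve `Y(τ) = (I + (τ/2) • W)⁻¹ * (I - (τ/2) • W) * X` is
(entrywise) differentiable at every `τ`, with derivative
`Y′(τ) = -(I + (τ/2) • W)⁻¹ * W * ((X + Y τ) / 2)`. -/
theorem cayley_curve_deriv {n p : ℕ}
    (X : Matrix (Fin n) (Fin p) ℝ) (hX : Xᵀ * X = 1)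
    (W : Matrix (Fin n) (Fin n) ℝ) (hW : Wᵀ = -W)
    (Y : ℝ → Matrix (Fin n) (Fin p) ℝ)
    (hY : ∀ τ : ℝ, Y τ =
      ((1 : Matrix (Fin n) (Fin n) ℝ) + (τ / 2) • W)⁻¹ *
        ((1 : Matrix (Fin n) (Fin n) ℝ) - (τ / 2) • W) * X) :
    ∀ (τ : ℝ) (i : Fin n) (j : Fin p),
      HasDerivAt (fun t => Y t i j)
        ((-(((1 : Matrix (Fin n) (Fin n) ℝ) + (τ / 2) • W)⁻¹ * W *
          ((1 / 2 : ℝ) • (X + Y τ)))) i j) τ := by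
  intro τ i j
  have hu : ∀ t : ℝ, IsUnit ((1 : Matrix (Fin n) (Fin n) ℝ) + (t / 2) • W).det :=
    fun t => (cayley_det_ne W hW _).isUnit
  have hAY : ∀ t : ℝ, Y t + (t / 2) • (W * Y t) = X - (t / 2) • (W * X) := by
    intro t
    have h : ((1 : Matrix (Fin n) (Fin n) ℝ) + (t / 2) • W) * Y t
        = ((1 : Matrix (Fin n) (Fin n) ℝ) - (t / 2) • W) * X := by
      rw [hY, Matrix.mul_assoc, Matrix.mul_nonsing_inv_cancel_left _ _ (hu t)]
    simpa [Matrix.add_mul, Matrix.sub_mul] using h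
  have hA : Continuous fun t : ℝ => (1 : Matrix (Fin n) (Fin n) ℝ) + (t / 2) • W := by
    fun_prop
  have hcont : Continuous Y := by
    have hinv : Continuous fun t : ℝ => ((1 : Matrix (Fin n) (Fin n) ℝ) + (t / 2) • W)⁻¹ := by
      simp only [Matrix.inv_def, Ring.inverse_eq_inv']
      exact (hA.matrix_det.inv₀ fun t => cayley_det_ne W hW _).smul hA.matrix_adjugate
    rw [show Y = _ from funext hY]
    refine (hinv.matrix_mul ?_).matrix_mul continuous_const
    fun_prop
  have hdiff : ∀ t : ℝ, Y t - Y τ = (t - τ) •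
      (-(((1 : Matrix (Fin n) (Fin n) ℝ) + (τ / 2) • W)⁻¹ * W *
          ((1 / 2 : ℝ) • (X + Y t)))) := by
    intro t
    have h : ((1 : Matrix (Fin n) (Fin n) ℝ) + (τ / 2) • W) * (Y t - Y τ)
        = (t - τ) • (-(W * ((1 / 2 : ℝ) • (X + Y t)))) := by
      have h1 := hAY t
      have h2 := hAY τ
      simp only [Matrix.add_mul, Matrix.one_mul, Matrix.mul_sub, Matrix.mul_add,
        Matrix.mul_smul, Matrix.smul_mul]
      linear_combination (norm := module) h1 - h2
    rw [← Matrix.nonsing_inv_mul_cancel_left _ (Y t - Y τ) (hu τ), h]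
    simp only [Matrix.mul_smul, Matrix.mul_neg, Matrix.mul_assoc]
  rw [hasDerivAt_iff_tendsto_slope]
  have hc : Continuous fun t => (-(((1 : Matrix (Fin n) (Fin n) ℝ) + (τ / 2) • W)⁻¹ * W *
          ((1 / 2 : ℝ) • (X + Y t)))) i j := by
    refine Continuous.matrix_elem ?_ i j
    exact (continuous_const.matrix_mul ((continuous_const.add hcont).const_smul (1 / 2 : ℝ))).neg
  refine ((hc.tendsto τ).mono_left nhdsWithin_le_nhds).congr' ?_
  filter_upwards [self_mem_nhdsWithin] with t ht
  have hne : t - τ ≠ 0 := sub_ne_zero.2 ht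
  have h := congrFun (congrFun (hdiff t) i) j
  rw [Matrix.sub_apply, Matrix.smul_apply, smul_eq_mul] at h
  rw [slope_def_field, h, mul_div_cancel_left₀ _ hne]
end

section
/- Let X ∈ ℝ^{n×p} satisfy XᵀX = I_p, let G ∈ ℝ^{n×p} be arbitrary, and set A = G Xᵀ − X Gᵀ ∈ ℝ^{n×n}. Then trace(Gᵀ A X) = (1/2)‖A‖_F², where ‖A‖_F² = trace(A Aᵀ) is the squared Frobenius norm. -/
open Matrix

/-- For `X` with `Xᵀ * X = 1` and arbitrary `G`, with `A = G * Xᵀ - X * Gᵀ`,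
one has `trace (Gᵀ * A * X) = (1/2) * trace (A * Aᵀ)` (half the squared Frobenius norm). -/
theorem trace_grad_cayley_descent {n p : ℕ}
    (X : Matrix (Fin n) (Fin p) ℝ) (hX : Xᵀ * X = 1)
    (G : Matrix (Fin n) (Fin p) ℝ)
    (A : Matrix (Fin n) (Fin n) ℝ) (hA : A = G * Xᵀ - X * Gᵀ) :
    Matrix.trace (Gᵀ * A * X) = (1 / 2) * Matrix.trace (A * Aᵀ) := by
  have hT : Aᵀ = X * Gᵀ - G * Xᵀ := by
    rw [hA]; simp [Matrix.transpose_sub, Matrix.transpose_mul]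
  have hneg : Aᵀ = -A := by rw [hT, hA]; abel
  have h1 : Matrix.trace (Gᵀ * A * X) = Matrix.trace (A * (X * Gᵀ)) := by
    rw [Matrix.mul_assoc, Matrix.trace_mul_comm, Matrix.mul_assoc]
  have h2 : Matrix.trace (A * (G * Xᵀ)) = - Matrix.trace (A * (X * Gᵀ)) := by
    rw [← Matrix.trace_transpose, Matrix.transpose_mul, Matrix.transpose_mul,
      Matrix.transpose_transpose, hneg, Matrix.mul_neg, Matrix.trace_neg,
      Matrix.trace_mul_comm]
  have h3 : Matrix.trace (A * Aᵀ)
      = Matrix.trace (A * (X * Gᵀ)) - Matrix.trace (A * (G * Xᵀ)) := by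
    rw [hT, Matrix.mul_sub, Matrix.trace_sub]
  rw [h3, h2, h1]
  ring
end

section
/- Let F : ℝ^{n×p} → ℝ be differentiable at X ∈ ℝ^{n×p}, where XᵀX = I_p, with gradient matrix G ∈ ℝ^{n×p} (i.e. the derivative of F at X in direction Z equals trace(GᵀZ) for all Z). Set A = G Xᵀ − X Gᵀ and define the Cayley curve Y(τ) = (I_n + (τ/2)A)⁻¹(I_n − (τ/2)A) X. Then the composite function τ ↦ F(Y(τ)) is differentiable at τ = 0 and its derivative there equals −(1/2)‖A‖_F². In particular, Y is a descent curve for F at τ = 0. -/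
open Matrix

attribute [local instance] Matrix.frobeniusNormedAddCommGroup Matrix.frobeniusNormedSpace

theorem cayley_aux {R : Type*} [NormedRing R] [NormedAlgebra ℝ R] [CompleteSpace R] (a : R) :
    HasDerivAt (fun τ : ℝ => Ring.inverse (1 + (τ / 2) • a) * (1 - (τ / 2) • a)) (-a) 0 := by
  have h0 : HasDerivAt (fun τ : ℝ => (τ / 2) • a) ((1 / 2 : ℝ) • a) 0 :=
    ((hasDerivAt_id (0 : ℝ)).div_const 2).smul_const a
  have h1 : HasDerivAt (fun τ : ℝ => 1 + (τ / 2) • a) ((1 / 2 : ℝ) • a) 0 := h0.const_add 1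
  have h2 : HasDerivAt (fun τ : ℝ => 1 - (τ / 2) • a) (-((1 / 2 : ℝ) • a)) 0 := h0.const_sub 1
  have hi := hasFDerivAt_ringInverse (𝕜 := ℝ) (1 : Rˣ)
  have h3 := HasFDerivAt.comp_hasDerivAt_of_eq (0 : ℝ) hi h1 (by simp)
  have h4 := h3.mul h2
  refine h4.congr_deriv ?_
  simp
  rw [← neg_add, ← add_smul]
  norm_num

/-- If `F` is (Fréchet) differentiable at `X` (with `Xᵀ * X = 1`) with gradient
matrix `G` (i.e. the derivative of `F` at `X` in direction `Z` is `trace (Gᵀ * Z)`), and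
`A = G * Xᵀ - X * Gᵀ`, then along the Cayley curve
`Y(τ) = (I + (τ/2) • A)⁻¹ * (I - (τ/2) • A) * X`, the function `τ ↦ F (Y τ)` is
differentiable at `0` with derivative `-(1/2) * trace (A * Aᵀ) = -(1/2)‖A‖_F²`. -/
theorem cayley_descent_curve {n p : ℕ}
    (F : Matrix (Fin n) (Fin p) ℝ → ℝ)
    (X : Matrix (Fin n) (Fin p) ℝ) (hX : Xᵀ * X = 1)
    (G : Matrix (Fin n) (Fin p) ℝ)
    (L : Matrix (Fin n) (Fin p) ℝ →L[ℝ] ℝ)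
    (hF : HasFDerivAt F L X)
    (hL : ∀ Z : Matrix (Fin n) (Fin p) ℝ, L Z = Matrix.trace (Gᵀ * Z))
    (A : Matrix (Fin n) (Fin n) ℝ) (hA : A = G * Xᵀ - X * Gᵀ)
    (Y : ℝ → Matrix (Fin n) (Fin p) ℝ)
    (hY : ∀ τ : ℝ, Y τ =
      ((1 : Matrix (Fin n) (Fin n) ℝ) + (τ / 2) • A)⁻¹ *
        ((1 : Matrix (Fin n) (Fin n) ℝ) - (τ / 2) • A) * X) :
    HasDerivAt (fun τ => F (Y τ)) (-(1 / 2) * Matrix.trace (A * Aᵀ)) 0 := by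
  have h1 : HasDerivAt (fun τ : ℝ => ((1 : Matrix (Fin n) (Fin n) ℝ) + (τ / 2) • A)⁻¹ *
        ((1 : Matrix (Fin n) (Fin n) ℝ) - (τ / 2) • A)) (-A) 0 := by
    let _ : NormedRing (Matrix (Fin n) (Fin n) ℝ) := Matrix.frobeniusNormedRing
    let _ : NormedAlgebra ℝ (Matrix (Fin n) (Fin n) ℝ) := Matrix.frobeniusNormedAlgebra
    have : CompleteSpace (Matrix (Fin n) (Fin n) ℝ) := FiniteDimensional.complete ℝ _
    simp only [Matrix.nonsing_inv_eq_ringInverse]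
    exact cayley_aux A
  let T : Matrix (Fin n) (Fin n) ℝ →ₗ[ℝ] Matrix (Fin n) (Fin p) ℝ :=
    { toFun := fun M => M * X
      map_add' := fun M N => Matrix.add_mul M N X
      map_smul' := fun c M => Matrix.smul_mul c M X }
  have h2 : HasDerivAt Y (-A * X) 0 := by
    have h := (LinearMap.toContinuousLinearMap T).hasFDerivAt.comp_hasDerivAt (0 : ℝ) h1
    have e : Y = fun τ => ((1 : Matrix (Fin n) (Fin n) ℝ) + (τ / 2) • A)⁻¹ *
        ((1 : Matrix (Fin n) (Fin n) ℝ) - (τ / 2) • A) * X := funext hY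
    rw [e]
    exact h
  have h3 := HasFDerivAt.comp_hasDerivAt_of_eq (0 : ℝ) hF h2 (by simp [hY])
  refine h3.congr_deriv ?_
  have hT : Aᵀ = X * Gᵀ - G * Xᵀ := by simp [hA]
  have hs : Aᵀ = -A := by rw [hT, hA]; simp
  have e1 : trace (A * (G * Xᵀ)) = - trace (A * (X * Gᵀ)) := by
    rw [← Matrix.trace_transpose (A * (G * Xᵀ)), Matrix.transpose_mul, hs, Matrix.transpose_mul,
      Matrix.transpose_transpose, Matrix.mul_neg, Matrix.trace_neg, Matrix.trace_mul_comm]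
  have e2 : trace (Gᵀ * (-A * X)) = - trace (A * (X * Gᵀ)) := by
    rw [Matrix.trace_mul_comm, Matrix.neg_mul, Matrix.neg_mul, Matrix.trace_neg, Matrix.mul_assoc]
  refine (hL (-A * X)).trans ?_
  rw [e2, hT, Matrix.mul_sub, Matrix.trace_sub, e1]
  ring
end

section
/- Let X ∈ ℝ^{n×p} satisfy XᵀX = I_p and let G ∈ ℝ^{n×p}. Then G − X Gᵀ X = 0 if and only if G Xᵀ − X Gᵀ = 0. -/
open Matrix

/-- For `X` with `Xᵀ * X = 1` and `G` arbitrary,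
`G - X * Gᵀ * X = 0` if and only if `G * Xᵀ - X * Gᵀ = 0`. -/
theorem grad_eq_zero_iff_A_eq_zero {n p : ℕ}
    (X : Matrix (Fin n) (Fin p) ℝ) (hX : Xᵀ * X = 1)
    (G : Matrix (Fin n) (Fin p) ℝ) :
    G - X * Gᵀ * X = 0 ↔ G * Xᵀ - X * Gᵀ = 0 := by
  rw [sub_eq_zero, sub_eq_zero]
  constructor
  · intro h
    have hM : Xᵀ * G = Gᵀ * X := by
      calc Xᵀ * G = Xᵀ * (X * Gᵀ * X) := by rw [← h]
        _ = (Xᵀ * X) * (Gᵀ * X) := by simp only [Matrix.mul_assoc]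
        _ = Gᵀ * X := by rw [hX, Matrix.one_mul]
    have hT : Gᵀ = Xᵀ * G * Xᵀ := by
      have h2 := congrArg Matrix.transpose h
      simpa [Matrix.transpose_mul, Matrix.mul_assoc] using h2
    calc G * Xᵀ = X * Gᵀ * X * Xᵀ := by rw [← h]
      _ = X * ((Gᵀ * X) * Xᵀ) := by simp only [Matrix.mul_assoc]
      _ = X * Gᵀ := by rw [← hM, ← hT]
  · intro h
    rw [← h, Matrix.mul_assoc, hX, Matrix.mul_one]
end

section
/- Let F : ℝ^{n×p} → ℝ be differentiable at X, where X is a local minimizer of F restricted to the Stiefel manifold {M ∈ ℝ^{n×p} : MᵀM = I_p}, and let G ∈ ℝ^{n×p} be the gradient matrix of F at X (so that the derivative of F at X in direction Z is trace(GᵀZ)). Then X satisfies the first-order optimality condition G − X Gᵀ X = 0; equivalently, with Lagrange multiplier Λ = GᵀX, we have G = XΛ and Λ is symmetric (GᵀX = XᵀG). -/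
open Matrix

attribute [local instance] Matrix.frobeniusNormedAddCommGroup Matrix.frobeniusNormedSpace

section
attribute [local instance] Matrix.frobeniusNormedRing Matrix.frobeniusNormedAlgebra

theorem stiefel_curve_deriv {n p : ℕ} (A : Matrix (Fin n) (Fin n) ℝ)
    (X : Matrix (Fin n) (Fin p) ℝ) :
    HasDerivAt (fun t : ℝ => NormedSpace.exp (t • A) * X) (A * X) 0 := by
  have h : HasDerivAt (fun t : ℝ => NormedSpace.exp (t • A)) A 0 := by
    have := hasDerivAt_exp_smul_const (𝕂 := ℝ) A (0 : ℝ)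
    simp only [zero_smul, NormedSpace.exp_zero, one_mul] at this
    exact this
  let R : Matrix (Fin n) (Fin n) ℝ →ₗ[ℝ] Matrix (Fin n) (Fin p) ℝ :=
    { toFun := fun M => M * X
      map_add' := fun a b => Matrix.add_mul a b X
      map_smul' := fun c a => Matrix.smul_mul c a X }
  exact (LinearMap.toContinuousLinearMap R).hasFDerivAt.comp_hasDerivAt (0 : ℝ) h

end

/-- If `X` is a local minimizer of `F` on the Stiefel manifold
`{M | Mᵀ * M = 1}`, and `F` is (Fréchet) differentiable at `X` with gradient matrix `G`
(i.e. the derivative of `F` at `X` in direction `Z` is `trace (Gᵀ * Z)`), then `X`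
satisfies the first-order optimality condition `G - X * Gᵀ * X = 0`; equivalently, with
Lagrange multiplier `Λ = Gᵀ * X`, we have `G = X * Λ` and `Λ` is symmetric
(`Gᵀ * X = Xᵀ * G`). -/
theorem stiefel_first_order_optimality {n p : ℕ}
    (F : Matrix (Fin n) (Fin p) ℝ → ℝ)
    (X : Matrix (Fin n) (Fin p) ℝ) (hX : Xᵀ * X = 1)
    (hmin : IsLocalMinOn F {M : Matrix (Fin n) (Fin p) ℝ | Mᵀ * M = 1} X)
    (G : Matrix (Fin n) (Fin p) ℝ)
    (L : Matrix (Fin n) (Fin p) ℝ →L[ℝ] ℝ)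
    (hF : HasFDerivAt F L X)
    (hL : ∀ Z : Matrix (Fin n) (Fin p) ℝ, L Z = Matrix.trace (Gᵀ * Z)) :
    G - X * Gᵀ * X = 0 ∧ G = X * (Gᵀ * X) ∧ Gᵀ * X = Xᵀ * G := by
  classical
  have key : ∀ A : Matrix (Fin n) (Fin n) ℝ, Aᵀ = -A → Matrix.trace (Gᵀ * (A * X)) = 0 := by
    intro A hA
    have hd := stiefel_curve_deriv A X
    have h0 : NormedSpace.exp ((0 : ℝ) • A) * X = X := by
      rw [zero_smul, NormedSpace.exp_zero, Matrix.one_mul]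
    have hmem : ∀ t : ℝ, (NormedSpace.exp (t • A) * X)ᵀ * (NormedSpace.exp (t • A) * X) = 1 := by
      intro t
      have hE : (NormedSpace.exp (t • A))ᵀ * NormedSpace.exp (t • A) = 1 := by
        rw [← Matrix.exp_transpose, Matrix.transpose_smul, hA, smul_neg,
          ← Matrix.exp_add_of_commute _ _ ((Commute.refl (t • A)).neg_left), neg_add_cancel,
          NormedSpace.exp_zero]
      rw [Matrix.transpose_mul, Matrix.mul_assoc, ← Matrix.mul_assoc _ _ X, hE, Matrix.one_mul, hX]
    have hF' : HasFDerivAt F L (NormedSpace.exp ((0 : ℝ) • A) * X) := by rw [h0]; exact hF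
    have hcomp : HasDerivAt (fun t : ℝ => F (NormedSpace.exp (t • A) * X)) (L (A * X)) 0 :=
      hF'.comp_hasDerivAt (0 : ℝ) hd
    have hloc : IsLocalMin (fun t : ℝ => F (NormedSpace.exp (t • A) * X)) 0 := by
      have ht : Filter.Tendsto (fun t : ℝ => NormedSpace.exp (t • A) * X) (nhds 0)
          (nhdsWithin X {M : Matrix (Fin n) (Fin p) ℝ | Mᵀ * M = 1}) := by
        refine tendsto_nhdsWithin_iff.2 ⟨?_, Filter.Eventually.of_forall hmem⟩
        have := hd.continuousAt.tendsto
        rwa [h0] at this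
      have := ht.eventually hmin
      filter_upwards [this] with t h
      rw [h0]
      exact h
    rw [← hL]
    exact hloc.hasDerivAt_eq_zero hcomp
  have hsym : G * Xᵀ - X * Gᵀ = 0 := by
    have hA : (G * Xᵀ - X * Gᵀ)ᵀ = -(G * Xᵀ - X * Gᵀ) := by
      simp [Matrix.transpose_mul]
    have h1 := key _ hA
    generalize hAd : G * Xᵀ - X * Gᵀ = A at *
    have h2 : Matrix.trace (X * Gᵀ * A) = 0 := by
      rw [Matrix.mul_assoc, Matrix.trace_mul_comm, Matrix.mul_assoc]; exact h1
    have h3 : Matrix.trace (G * Xᵀ * A) = 0 := by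
      rw [← Matrix.trace_transpose, Matrix.transpose_mul, Matrix.transpose_mul,
        Matrix.transpose_transpose, hA, Matrix.neg_mul, Matrix.trace_neg, Matrix.trace_mul_comm,
        h2, neg_zero]
    have h4 : Matrix.trace (Aᴴ * A) = 0 := by
      rw [Matrix.conjTranspose_eq_transpose_of_trivial, hA, ← hAd, Matrix.neg_mul, hAd]
      nth_rewrite 1 [← hAd]
      rw [Matrix.sub_mul, Matrix.trace_neg, Matrix.trace_sub, h2, h3]; simp
    exact Matrix.trace_conjTranspose_mul_self_eq_zero_iff.1 h4
  have hG : G = X * (Gᵀ * X) := by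
    have := congrArg (· * X) (sub_eq_zero.1 hsym)
    simpa [Matrix.mul_assoc, hX] using this
  refine ⟨?_, hG, ?_⟩
  · rw [Matrix.mul_assoc, ← hG, sub_self]
  · have := congrArg (Xᵀ * ·) hG
    simp only [← Matrix.mul_assoc, hX, Matrix.one_mul] at this
    exact this.symm
end
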